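/- arXiv:2401.16261 — 5 statements merged into one kernel-verified Lean document; each statement's English description precedes it below -/
import Mathlib

section
/- Let D, R, A, φ₀, t > 0 and 0 < r < R, and define Φ̃_D(t) = 4πA(R+r)(R−r) / [(R+r)·exp(−(R−r)²/(4Dt)) − (R−r)·exp(−(R+r)²/(4Dt))] and Φ̃_C(t) = 2πR·exp(R²/(4Dt))·(φ₀ + A − 2A(R+r)/[(R+r) − (R−r)·exp(−Rr/(Dt))]). Then (1/(2πR))Φ̃_C(t)·exp(−R²/(4Dt)) + (1/(2π(R−r)))Φ̃_D(t)·exp(−(R−r)²/(4Dt)) = φ₀ + A, and (1/(2πR))Φ̃_C(t)·exp(−R²/(4Dt)) + (1/(2π(R+r)))Φ̃_D(t)·exp(−(R+r)²/(4Dt)) = φ₀ − A. -/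
open Real

/-- The intensities of formula (8) solve the extreme-point matching conditions (7). -/
theorem stmt_4 (D R A φ₀ t r : ℝ) (hD : 0 < D) (hR : 0 < R) (hA : 0 < A)
    (hφ₀ : 0 < φ₀) (ht : 0 < t) (hr : 0 < r) (hrR : r < R)
    (ΦD ΦC : ℝ)
    (hΦD : ΦD = 4 * π * A * (R + r) * (R - r) /
      ((R + r) * Real.exp (-(R - r) ^ 2 / (4 * D * t)) -
        (R - r) * Real.exp (-(R + r) ^ 2 / (4 * D * t))))
    (hΦC : ΦC = 2 * π * R * Real.exp (R ^ 2 / (4 * D * t)) *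
      (φ₀ + A - 2 * A * (R + r) /
        ((R + r) - (R - r) * Real.exp (-(R * r) / (D * t))))) :
    1 / (2 * π * R) * ΦC * Real.exp (-R ^ 2 / (4 * D * t)) +
        1 / (2 * π * (R - r)) * ΦD * Real.exp (-(R - r) ^ 2 / (4 * D * t)) = φ₀ + A ∧
    1 / (2 * π * R) * ΦC * Real.exp (-R ^ 2 / (4 * D * t)) +
        1 / (2 * π * (R + r)) * ΦD * Real.exp (-(R + r) ^ 2 / (4 * D * t)) = φ₀ - A := by
  have hq : Real.exp (-(R + r) ^ 2 / (4 * D * t)) =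
      Real.exp (-(R - r) ^ 2 / (4 * D * t)) * Real.exp (-(R * r) / (D * t)) := by
    rw [← Real.exp_add]
    congr 1
    field_simp
    ring
  have hP : Real.exp (R ^ 2 / (4 * D * t)) * Real.exp (-R ^ 2 / (4 * D * t)) = 1 := by
    rw [← Real.exp_add, neg_div, add_neg_cancel, Real.exp_zero]
  have hq1 : Real.exp (-(R * r) / (D * t)) < 1 := by
    rw [Real.exp_lt_one_iff, neg_div]
    have : 0 < R * r / (D * t) := by positivity
    linarith
  rw [hq] at hΦD ⊢
  have hE : Real.exp (-(R - r) ^ 2 / (4 * D * t)) ≠ 0 := Real.exp_ne_zero _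
  generalize Real.exp (-(R - r) ^ 2 / (4 * D * t)) = E at *
  generalize Real.exp (-(R * r) / (D * t)) = q at *
  generalize Real.exp (R ^ 2 / (4 * D * t)) = P at *
  generalize Real.exp (-R ^ 2 / (4 * D * t)) = P' at *
  have h1 : R - r ≠ 0 := by linarith
  have h2 : R + r ≠ 0 := by linarith
  have hden : (R + r) - (R - r) * q ≠ 0 := by nlinarith
  have hpi : π ≠ 0 := Real.pi_ne_zero
  have hC : 1 / (2 * π * R) * ΦC * P' =
      φ₀ + A - 2 * A * (R + r) / ((R + r) - (R - r) * q) := by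
    rw [hΦC]
    generalize φ₀ + A - 2 * A * (R + r) / ((R + r) - (R - r) * q) = X
    calc _ = (2 * π * R) / (2 * π * R) * (P * P') * X := by ring
      _ = X := by rw [hP, div_self (by positivity)]; ring
  have hDD : ΦD * E = 4 * π * A * (R + r) * (R - r) / ((R + r) - (R - r) * q) := by
    rw [hΦD, show (R + r) * E - (R - r) * (E * q) = E * ((R + r) - (R - r) * q) by ring]
    generalize (R + r) - (R - r) * q = d at *
    field_simp
  rw [hC, mul_assoc _ ΦD E, mul_assoc _ ΦD (E * q), ← mul_assoc ΦD E q, hDD]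
  constructor
  · generalize (R + r) - (R - r) * q = d at *
    field_simp
    ring
  · generalize hd : (R + r) - (R - r) * q = d at *
    field_simp
    rw [← hd]
    ring
end

section
/- Let D, R, A, t > 0 and 0 < r < R. Then Φ̃_D(t) = 4πA(R+r)(R−r) / [(R+r)·exp(−(R−r)²/(4Dt)) − (R−r)·exp(−(R+r)²/(4Dt))] is strictly positive; in particular the denominator (R+r)·exp(−(R−r)²/(4Dt)) − (R−r)·exp(−(R+r)²/(4Dt)) is strictly positive. -/
open Real

/-- The non-centred intensity `Φ̃_D(t)` is strictly positive, and so is its denominator. -/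
theorem stmt_6 (D R A t r : ℝ) (hD : 0 < D) (hR : 0 < R) (hA : 0 < A)
    (ht : 0 < t) (hr : 0 < r) (hrR : r < R) :
    0 < (R + r) * Real.exp (-(R - r) ^ 2 / (4 * D * t)) -
          (R - r) * Real.exp (-(R + r) ^ 2 / (4 * D * t)) ∧
    0 < 4 * π * A * (R + r) * (R - r) /
          ((R + r) * Real.exp (-(R - r) ^ 2 / (4 * D * t)) -
            (R - r) * Real.exp (-(R + r) ^ 2 / (4 * D * t))) := by
  have hs : 0 < R - r := sub_pos.mpr hrR
  have hden : 0 < (R + r) * Real.exp (-(R - r) ^ 2 / (4 * D * t)) -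
      (R - r) * Real.exp (-(R + r) ^ 2 / (4 * D * t)) := by
    have he : Real.exp (-(R + r) ^ 2 / (4 * D * t)) ≤
        Real.exp (-(R - r) ^ 2 / (4 * D * t)) := by
      apply Real.exp_le_exp.mpr
      apply div_le_div_of_nonneg_right _ (by positivity)
      nlinarith [mul_pos hR hr]
    have hp := Real.exp_pos (-(R - r) ^ 2 / (4 * D * t))
    have h1 := mul_le_mul_of_nonneg_left he hs.le
    have h2 := mul_pos hr hp
    nlinarith
  exact ⟨hden, by positivity⟩
end

section
/- Let D, R, t > 0, 0 < r < R, and suppose A = φ₀ > 0. Then Φ̃_C(t) = 2πR·exp(R²/(4Dt))·(φ₀ + A − 2A(R+r)/[(R+r) − (R−r)·exp(−Rr/(Dt))]) is strictly negative. -/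
open Real

/-- If `A = φ₀`, the central intensity `Φ̃_C(t)` is strictly negative. -/
theorem stmt_7 (D R t r A φ₀ : ℝ) (hD : 0 < D) (hR : 0 < R) (ht : 0 < t)
    (hr : 0 < r) (hrR : r < R) (hφ₀ : 0 < φ₀) (hA : A = φ₀) :
    2 * π * R * Real.exp (R ^ 2 / (4 * D * t)) *
        (φ₀ + A - 2 * A * (R + r) /
          ((R + r) - (R - r) * Real.exp (-(R * r) / (D * t)))) < 0 := by
  subst hA
  have hE0 : 0 < Real.exp (-(R * r) / (D * t)) := Real.exp_pos _
  have hE1 : Real.exp (-(R * r) / (D * t)) < 1 := by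
    rw [Real.exp_lt_one_iff]
    exact div_neg_of_neg_of_pos (by have := mul_pos hR hr; linarith) (mul_pos hD ht)
  generalize Real.exp (-(R * r) / (D * t)) = E at hE0 hE1 ⊢
  have h1 : 0 < (R - r) * E := mul_pos (by linarith) hE0
  have h2 : (R - r) * E < R - r := by nlinarith
  have hden : 0 < (R + r) - (R - r) * E := by linarith
  apply mul_neg_of_pos_of_neg (by positivity)
  rw [sub_neg, lt_div_iff₀ hden]
  nlinarith [mul_pos hφ₀ h1]
end

section
/- Let D, R, A > 0, 0 < r < R, and ε > 0. Then the function t ↦ Φ̃_D(t) = 4πA(R+r)(R−r) / [(R+r)·exp(−(R−r)²/(4Dt)) − (R−r)·exp(−(R+r)²/(4Dt))] is not Lebesgue integrable on the interval (0, ε). -/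
open Real MeasureTheory

/-- The intensity `Φ̃_D` is not Lebesgue integrable on `(0, ε)`. -/
theorem stmt_10 (D R A r ε : ℝ) (hD : 0 < D) (hR : 0 < R) (hA : 0 < A)
    (hr : 0 < r) (hrR : r < R) (hε : 0 < ε) :
    ¬ IntegrableOn (fun t : ℝ =>
        4 * π * A * (R + r) * (R - r) /
          ((R + r) * Real.exp (-(R - r) ^ 2 / (4 * D * t)) -
            (R - r) * Real.exp (-(R + r) ^ 2 / (4 * D * t))))
      (Set.Ioo 0 ε) volume := by
  intro h
  have hs : 0 < R - r := sub_pos.2 hrR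
  have hp : 0 < R + r := by linarith
  have hpi := Real.pi_pos
  set K : ℝ := 4 * π * A * (R - r) * ((R - r) ^ 2 / (4 * D)) with hK
  have hKpos : 0 < K := by positivity
  have hinv : IntegrableOn (fun t : ℝ => K * t⁻¹) (Set.Ioo 0 ε) volume := by
    refine Integrable.mono' h (by fun_prop) ?_
    refine (ae_restrict_iff' measurableSet_Ioo).2 (Filter.Eventually.of_forall ?_)
    intro t ht
    have ht0 : 0 < t := ht.1
    rw [Real.norm_of_nonneg (by positivity)]
    set x := (R - r) ^ 2 / (4 * D * t) with hx
    have hxpos : 0 < x := by positivity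
    have e1 : -(R - r) ^ 2 / (4 * D * t) = -x := by rw [hx]; ring
    have hle : Real.exp (-(R + r) ^ 2 / (4 * D * t)) ≤ Real.exp (-x) := by
      rw [← e1]
      apply Real.exp_le_exp.2
      apply div_le_div_of_nonneg_right _ (by positivity)
      nlinarith [mul_pos hr hR]
    rw [e1]
    have e2 := Real.exp_pos (-x)
    have e3 := Real.exp_pos (-(R + r) ^ 2 / (4 * D * t))
    have hden : 0 < (R + r) * Real.exp (-x) -
        (R - r) * Real.exp (-(R + r) ^ 2 / (4 * D * t)) := by
      have := mul_le_mul_of_nonneg_left hle hs.le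
      have := mul_pos hr e2
      nlinarith
    rw [le_div_iff₀ hden]
    have hx1 : x * Real.exp (-x) ≤ 1 := by
      have h1 := Real.add_one_le_exp x
      calc x * Real.exp (-x) ≤ Real.exp x * Real.exp (-x) := by
            apply mul_le_mul_of_nonneg_right (by linarith) e2.le
        _ = 1 := by rw [← Real.exp_add]; simp
    have hKt : K * t⁻¹ = 4 * π * A * (R - r) * x := by
      rw [hK, hx]; field_simp
    rw [hKt]
    calc 4 * π * A * (R - r) * x * ((R + r) * Real.exp (-x) -
        (R - r) * Real.exp (-(R + r) ^ 2 / (4 * D * t)))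
        ≤ 4 * π * A * (R - r) * x * ((R + r) * Real.exp (-x)) := by
          apply mul_le_mul_of_nonneg_left _ (by positivity)
          have := mul_pos hs e3
          linarith
      _ = 4 * π * A * (R + r) * (R - r) * (x * Real.exp (-x)) := by ring
      _ ≤ 4 * π * A * (R + r) * (R - r) * 1 :=
          mul_le_mul_of_nonneg_left hx1 (by positivity)
      _ = _ := by ring
  have h2 : IntegrableOn (fun t : ℝ => t⁻¹) (Set.Ioo 0 ε) volume := by
    have := hinv.const_mul K⁻¹
    refine this.congr (Filter.Eventually.of_forall fun t => ?_)
    simp only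
    field_simp
  have h3 : IntervalIntegrable (fun t : ℝ => t⁻¹) volume 0 ε := by
    rw [intervalIntegrable_iff_integrableOn_Ioo_of_le hε.le]
    exact h2
  rw [intervalIntegrable_inv_iff] at h3
  rcases h3 with h3 | h3
  · exact hε.ne h3
  · exact h3 (Set.left_mem_uIcc)
end

section
/- Let D, R, φ₀, A > 0, 0 < r < R, and θ ∈ ℝ. Define φ̃(θ, t) = (1/(2πR))[ Φ̃_C(t)·exp(−R²/(4Dt)) + Φ̃_D(t)·((R² − Rr sin θ)/(R² + r² − 2Rr sin θ))·exp(−(R² + r² − 2Rr sin θ)/(4Dt)) ], where Φ̃_D(t) = 4πA(R+r)(R−r) / [(R+r)·exp(−(R−r)²/(4Dt)) − (R−r)·exp(−(R+r)²/(4Dt))] and Φ̃_C(t) = 2πR·exp(R²/(4Dt))·(φ₀ + A − 2A(R+r)/[(R+r) − (R−r)·exp(−Rr/(Dt))]). Then, as t → +∞, φ̃(θ, t) tends to φ₀ + A + A(R+r)²(sin θ − 1)/(R² + r² − 2Rr sin θ). -/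
open Real Filter

/-- Long-time limit of the emergent flux density `φ̃(θ, t)` of the two-point model. -/
theorem stmt_14 (D R φ₀ A r θ : ℝ) (hD : 0 < D) (hR : 0 < R) (hφ₀ : 0 < φ₀)
    (hA : 0 < A) (hr : 0 < r) (hrR : r < R) :
    Tendsto (fun t : ℝ =>
        1 / (2 * π * R) *
          ((2 * π * R * Real.exp (R ^ 2 / (4 * D * t)) *
              (φ₀ + A - 2 * A * (R + r) /
                ((R + r) - (R - r) * Real.exp (-(R * r) / (D * t))))) *
              Real.exp (-R ^ 2 / (4 * D * t)) +
            (4 * π * A * (R + r) * (R - r) /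
              ((R + r) * Real.exp (-(R - r) ^ 2 / (4 * D * t)) -
                (R - r) * Real.exp (-(R + r) ^ 2 / (4 * D * t)))) *
              ((R ^ 2 - R * r * Real.sin θ) / (R ^ 2 + r ^ 2 - 2 * R * r * Real.sin θ)) *
              Real.exp (-(R ^ 2 + r ^ 2 - 2 * R * r * Real.sin θ) / (4 * D * t))))
      atTop
      (nhds (φ₀ + A + A * (R + r) ^ 2 * (Real.sin θ - 1) /
        (R ^ 2 + r ^ 2 - 2 * R * r * Real.sin θ))) := by
  have hE : ∀ c k : ℝ, 0 < k → Tendsto (fun t : ℝ => Real.exp (c / (k * t))) atTop (nhds 1) := by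
    intro c k hk
    have h : Tendsto (fun t : ℝ => c / (k * t)) atTop (nhds 0) :=
      tendsto_const_nhds.div_atTop (tendsto_id.const_mul_atTop hk)
    simpa [Function.comp_def] using (Real.continuous_exp.tendsto 0).comp h
  have h4 : 0 < 4 * D := by positivity
  have hQ : 0 < R ^ 2 + r ^ 2 - 2 * R * r * Real.sin θ := by
    nlinarith [Real.sin_le_one θ, mul_pos hR hr, pow_pos (sub_pos.2 hrR) 2,
      mul_nonneg (mul_pos hR hr).le (sub_nonneg.2 (Real.sin_le_one θ))]
  have hd : (R + r) - (R - r) * 1 ≠ 0 := by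
    intro h; linarith
  have hd' : (R + r) * 1 - (R - r) * 1 ≠ 0 := by
    intro h; linarith
  have h1 := (((hE (R ^ 2) _ h4).const_mul (2 * π * R)).mul
    ((tendsto_const_nhds (x := 2 * A * (R + r))).div
      (((hE (-(R * r)) _ hD).const_mul (R - r)).const_sub (R + r)) hd |>.const_sub (φ₀ + A))).mul
    (hE (-R ^ 2) _ h4)
  have h2 := (((tendsto_const_nhds (x := 4 * π * A * (R + r) * (R - r))).div
      (((hE (-(R - r) ^ 2) _ h4).const_mul (R + r)).sub
        ((hE (-(R + r) ^ 2) _ h4).const_mul (R - r))) hd').mul_const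
      ((R ^ 2 - R * r * Real.sin θ) / (R ^ 2 + r ^ 2 - 2 * R * r * Real.sin θ))).mul
    (hE (-(R ^ 2 + r ^ 2 - 2 * R * r * Real.sin θ)) _ h4)
  have h3 := (h1.add h2).const_mul (1 / (2 * π * R))
  convert h3 using 2
  · rfl
  have e1 : (R + r) - (R - r) * 1 = 2 * r := by ring
  have e2 : (R + r) * 1 - (R - r) * 1 = 2 * r := by ring
  rw [e1, e2]
  have hpi := Real.pi_ne_zero
  have hQ' := hQ.ne'
  generalize Real.sin θ = s at *
  obtain ⟨Q, hQe⟩ : ∃ Q, Q = R ^ 2 + r ^ 2 - 2 * R * r * s := ⟨_, rfl⟩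
  rw [← hQe] at hQ' ⊢
  field_simp
  rw [hQe]
  ring
end
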